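/- Let l₁ > l₂ > 0, and let A, B, C and A', B', C' be two triangles (noncollinear triples) in EuclideanSpace ℝ (Fin 2), both satisfying the angle ordering ∠ A B C < ∠ B A C < ∠ B C A (respectively ∠ A' B' C' < ∠ B' A' C' < ∠ B' C' A'), and both having bisector lengths t_A = t_{A'} = l₂ and t_B = t_{B'} = l₁. If ∠ A B C < ∠ A' B' C', then t_C < t_{C'}, ∠ B A C < ∠ B' A' C', and ∠ B C A > ∠ B' C' A'. (Among triangles with two fixed bisector lengths and this angle ordering, the third bisector length and the angle at A are strictly increasing, and the angle at C strictly decreasing, functions of the angle at B.) -/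

import Mathlib

open EuclideanGeometry Real

/-- The length of the internal angle bisector from vertex `A` in triangle `A B C`:
the distance from `A` to the point on `BC` dividing it in ratio `AB : AC`. -/
noncomputable def bisectorLength (A B C : EuclideanSpace ℝ (Fin 2)) : ℝ :=
  dist A (((dist C A) / (dist C A + dist A B)) • B + ((dist A B) / (dist C A + dist A B)) • C)

/-- The law of cosines form of the bisector length: `t_A (b + c) = 2 b c cos (A / 2)`. -/
lemma bisectorLength_mul_add_eq (A B C : EuclideanSpace ℝ (Fin 2)) (hs : 0 < dist C A + dist A B) :
    bisectorLength A B C * (dist C A + dist A B) =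
      2 * dist C A * dist A B * cos (∠ B A C / 2) := by
  have hcos : 0 ≤ cos (∠ B A C / 2) := by
    apply cos_nonneg_of_neg_pi_div_two_le_of_le <;>
      linarith [angle_nonneg B A C, angle_le_pi B A C, pi_pos]
  have hc2 : cos (∠ B A C) = 2 * cos (∠ B A C / 2) ^ 2 - 1 := by
    rw [← cos_two_mul]; ring_nf
  have hinner := (InnerProductGeometry.cos_angle_mul_norm_mul_norm (B -ᵥ A) (C -ᵥ A)).symm
  rw [← EuclideanGeometry.angle, ← dist_eq_norm_vsub, ← dist_eq_norm_vsub, dist_comm B A] at hinner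
  have hB : ‖B -ᵥ A‖ = dist A B := by rw [← dist_eq_norm_vsub, dist_comm]
  have hC : ‖C -ᵥ A‖ = dist C A := by rw [← dist_eq_norm_vsub]
  set b := dist C A with hb
  set c := dist A B with hc
  have hb0 : 0 ≤ b := dist_nonneg
  have hc0 : 0 ≤ c := dist_nonneg
  have hvec : (b + c) • ((b / (b + c)) • B + (c / (b + c)) • C - A) =
      b • (B -ᵥ A) + c • (C -ᵥ A) := by
    have h1 : (b + c) * (b / (b + c)) = b := by field_simp
    have h2 : (b + c) * (c / (b + c)) = c := by field_simp
    rw [smul_sub, smul_add, smul_smul, smul_smul, h1, h2, vsub_eq_sub, vsub_eq_sub]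
    module
  have hnorm : bisectorLength A B C * (b + c) = ‖b • (B -ᵥ A) + c • (C -ᵥ A)‖ := by
    rw [← hvec, norm_smul, Real.norm_of_nonneg hs.le, mul_comm, bisectorLength, dist_comm,
      dist_eq_norm]
  rw [hnorm, ← abs_of_nonneg (a := 2 * b * c * cos (∠ B A C / 2)) (by positivity),
    ← abs_of_nonneg (norm_nonneg (b • (B -ᵥ A) + c • (C -ᵥ A))), ← sq_eq_sq_iff_abs_eq_abs,
    norm_add_sq_real, norm_smul, norm_smul, inner_smul_left, inner_smul_right, hinner, hB, hC, hc2,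
    Real.norm_of_nonneg hb0, Real.norm_of_nonneg hc0]
  simp only [conj_trivial]
  ring

/-- `t_A cos ((B - C) / 2) = k sin B sin C`, where `k` is the circumdiameter. -/
lemma bisectorLength_mul_cos_eq {A B C : EuclideanSpace ℝ (Fin 2)} {k β γ : ℝ} (hk : 0 < k)
    (hb : dist C A = k * sin β) (hc : dist A B = k * sin γ) (hβ : 0 < sin β) (hγ : 0 < sin γ)
    (hA : ∠ B A C < π) (hsum : ∠ B A C + β + γ = π) :
    bisectorLength A B C * cos ((β - γ) / 2) = k * sin β * sin γ := by
  have hmul := bisectorLength_mul_add_eq A B C (by rw [hb, hc]; positivity)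
  have hcos : 0 < cos (∠ B A C / 2) := by
    apply cos_pos_of_mem_Ioo
    constructor <;> linarith [angle_nonneg B A C, pi_pos]
  have hadd : sin β + sin γ = 2 * cos (∠ B A C / 2) * cos ((β - γ) / 2) := by
    have h1 : ∠ B A C / 2 = π / 2 - (β + γ) / 2 := by linarith
    rw [h1, cos_pi_div_two_sub]
    have h2 : β = (β + γ) / 2 + (β - γ) / 2 := by ring
    have h3 : γ = (β + γ) / 2 - (β - γ) / 2 := by ring
    conv_lhs => rw [h2, h3]
    rw [sin_add, sin_sub]
    ring_nf
  rw [hb, hc, ← mul_add, hadd] at hmul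
  have h2 : 0 < 2 * k * cos (∠ B A C / 2) := by positivity
  apply mul_left_cancel₀ h2.ne'
  linear_combination hmul

/-- The relations between bisector lengths and the half angles `a` at `A` and `b` at `B`. -/
lemma bisectorLength_half_angle_relations {A B C : EuclideanSpace ℝ (Fin 2)} {a b : ℝ}
    (h : ¬ Collinear ℝ ({A, B, C} : Set (EuclideanSpace ℝ (Fin 2))))
    (ha : ∠ B A C = 2 * a) (hb : ∠ A B C = 2 * b) :
    ∠ B C A = π - 2 * a - 2 * b ∧ 0 < a ∧ 0 < b ∧ a + b < π / 2 ∧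
    bisectorLength B C A * (sin (2 * a + b) * sin (2 * b)) =
      bisectorLength A B C * (sin (2 * a) * sin (a + 2 * b)) ∧
    bisectorLength C A B * (sin (2 * a + 2 * b) * cos (a - b)) =
      bisectorLength B C A * (sin (2 * a + b) * sin (2 * b)) := by
  have hBCA : ¬ Collinear ℝ ({B, C, A} : Set (EuclideanSpace ℝ (Fin 2))) := by
    convert h using 2; ext; simp; tauto
  have hBAC : ¬ Collinear ℝ ({B, A, C} : Set (EuclideanSpace ℝ (Fin 2))) := by
    convert h using 2; ext; simp; tauto
  have hAB : A ≠ B := ne₁₂_of_not_collinear h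
  have hBC : B ≠ C := ne₂₃_of_not_collinear h
  have hsum := angle_add_angle_add_angle_eq_pi (p₁ := A) (p₂ := B) C hAB.symm
  rw [angle_comm C A B] at hsum
  have hA0 := angle_pos_of_not_collinear hBAC
  have hB0 := angle_pos_of_not_collinear h
  have hC0 := angle_pos_of_not_collinear hBCA
  have hCeq : ∠ B C A = π - 2 * a - 2 * b := by linarith
  have hsC : sin (∠ B C A) = sin (2 * a + 2 * b) := by
    rw [hCeq, ← sin_pi_sub]; ring_nf
  have hA := sin_pos_of_pos_of_lt_pi hA0 (angle_lt_pi_of_not_collinear hBAC)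
  have hB := sin_pos_of_pos_of_lt_pi hB0 (angle_lt_pi_of_not_collinear h)
  have hC := sin_pos_of_pos_of_lt_pi hC0 (angle_lt_pi_of_not_collinear hBCA)
  have hlAB := law_sin A B C
  rw [angle_comm C A B] at hlAB
  have hlBC := law_sin B C A
  have hBCd : 0 < dist B C := dist_pos.2 hBC
  obtain ⟨k, hk, hka⟩ : ∃ k, 0 < k ∧ dist B C = k * sin (∠ B A C) :=
    ⟨dist B C / sin (∠ B A C), by positivity, by field_simp⟩
  have hkb : dist C A = k * sin (∠ A B C) := by
    apply mul_left_cancel₀ hA.ne'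
    rw [← hlAB, hka]
    ring
  have hkc : dist A B = k * sin (∠ B C A) := by
    apply mul_left_cancel₀ hB.ne'
    rw [← hlBC, hkb]
    ring
  have htA := bisectorLength_mul_cos_eq hk hkb hkc hB hC
    (angle_lt_pi_of_not_collinear hBAC) (by linarith)
  have htB := bisectorLength_mul_cos_eq (A := B) (B := C) (C := A) hk hkc hka hC hA
    (by rw [angle_comm]; exact angle_lt_pi_of_not_collinear h) (by rw [angle_comm C B A]; linarith)
  have htC := bisectorLength_mul_cos_eq (A := C) (B := A) (C := B) hk hka hkb hA hB
    (by rw [angle_comm]; exact angle_lt_pi_of_not_collinear hBCA)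
    (by rw [angle_comm A C B]; linarith)
  have c1 : cos ((∠ A B C - ∠ B C A) / 2) = sin (a + 2 * b) := by
    rw [hCeq, hb, ← cos_sub_pi_div_two]; ring_nf
  have c2 : cos ((∠ B C A - ∠ B A C) / 2) = sin (2 * a + b) := by
    rw [hCeq, ha, ← cos_pi_div_two_sub]; ring_nf
  have c3 : cos ((∠ B A C - ∠ A B C) / 2) = cos (a - b) := by
    rw [ha, hb]; ring_nf
  rw [c1, hsC, hb] at htA
  rw [c2, hsC, ha] at htB
  rw [c3, hb, ha] at htC
  exact ⟨hCeq, by linarith, by linarith, by linarith,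
    by linear_combination sin (2 * b) * htB - sin (2 * a) * htA,
    by linear_combination sin (2 * a + 2 * b) * htC - sin (2 * b) * htB⟩

lemma sin_div_sin_add_lt {x y s : ℝ} (hx : 0 < x) (hxy : x < y) (hs : 0 < s) (hy : y + s < π) :
    sin x / sin (x + s) < sin y / sin (y + s) := by
  rw [div_lt_div_iff₀ (sin_pos_of_pos_of_lt_pi (by linarith) (by linarith))
    (sin_pos_of_pos_of_lt_pi (by linarith) hy)]
  have h1 : 0 < sin (y - x) * sin s :=
    mul_pos (sin_pos_of_pos_of_lt_pi (by linarith) (by linarith))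
      (sin_pos_of_pos_of_lt_pi hs (by linarith))
  have h2 : sin y * sin (x + s) - sin x * sin (y + s) = sin (y - x) * sin s := by
    rw [sin_add, sin_add, sin_sub]; ring
  linarith

lemma sin_add_div_sin_lt {x y s : ℝ} (hx : 0 < x) (hxy : x < y) (hs : 0 < s) (hy : y + s < π) :
    sin (y + s) / sin y < sin (x + s) / sin x := by
  have h := sin_div_sin_add_lt hx hxy hs hy
  have h0 : 0 < sin x / sin (x + s) :=
    div_pos (sin_pos_of_pos_of_lt_pi hx (by linarith))
      (sin_pos_of_pos_of_lt_pi (by linarith) (by linarith))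
  simpa using inv_strictAnti₀ h0 h

lemma sin_lt_sin_of_pos {x y : ℝ} (hx : 0 < x) (hxy : x < y) (hy : y < π / 2) : sin x < sin y :=
  sin_lt_sin_of_lt_of_le_pi_div_two (by linarith [pi_pos]) hy.le hxy

/-- The ratio `t_B / t_A` in terms of the half angles `a` at `A` and `b` at `B`. -/
noncomputable def bisectorRatioBA (a b : ℝ) : ℝ :=
  sin (2 * a) * sin (a + 2 * b) / (sin (2 * a + b) * sin (2 * b))

/-- The ratio `t_C / t_B` in terms of the half angles `a` at `A` and `b` at `B`. -/
noncomputable def bisectorRatioCB (a b : ℝ) : ℝ :=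
  sin (2 * a + b) * sin (2 * b) / (sin (2 * a + 2 * b) * cos (a - b))

lemma bisectorRatioBA_strictAnti_right {a b b' : ℝ} (hb : 0 < b) (hbb : b < b') (ha : b' < a)
    (h : 2 * a + b' < π / 2) : bisectorRatioBA a b' < bisectorRatioBA a b := by
  have h1 := sin_add_div_sin_lt (x := 2 * b) (y := 2 * b') (s := a)
    (by linarith) (by linarith) (by linarith) (by linarith)
  have h2 := sin_lt_sin_of_pos (x := 2 * a + b) (y := 2 * a + b')
    (by linarith) (by linarith) (by linarith)
  have p1 : 0 < sin (2 * a) := sin_pos_of_pos_of_lt_pi (by linarith) (by linarith)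
  have p2 : 0 < sin (2 * a + b) := sin_pos_of_pos_of_lt_pi (by linarith) (by linarith)
  have p3 : 0 < sin (2 * b' + a) / sin (2 * b') :=
    div_pos (sin_pos_of_pos_of_lt_pi (by linarith) (by linarith))
      (sin_pos_of_pos_of_lt_pi (by linarith) (by linarith))
  have p4 := p2.trans h2
  have key : sin (2 * a) / sin (2 * a + b') * (sin (2 * b' + a) / sin (2 * b')) <
      sin (2 * a) / sin (2 * a + b) * (sin (2 * b + a) / sin (2 * b)) := by
    gcongr
  rw [bisectorRatioBA, bisectorRatioBA, mul_div_mul_comm, mul_div_mul_comm, add_comm a,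
    add_comm a]
  exact key

lemma bisectorRatioBA_strictMono_left {a a' b : ℝ} (hb : 0 < b) (ha : b < a) (haa : a < a')
    (h : 2 * a' + b < π / 2) : bisectorRatioBA a b < bisectorRatioBA a' b := by
  have h1 := sin_div_sin_add_lt (x := 2 * a) (y := 2 * a') (s := b)
    (by linarith) (by linarith) (by linarith) (by linarith)
  have h2 := sin_lt_sin_of_pos (x := a + 2 * b) (y := a' + 2 * b)
    (by linarith) (by linarith) (by linarith)
  have p1 : 0 < sin (2 * b) := sin_pos_of_pos_of_lt_pi (by linarith) (by linarith)
  have p2 : 0 < sin (a + 2 * b) := sin_pos_of_pos_of_lt_pi (by linarith) (by linarith)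
  have p3 : 0 < sin (2 * a) / sin (2 * a + b) :=
    div_pos (sin_pos_of_pos_of_lt_pi (by linarith) (by linarith))
      (sin_pos_of_pos_of_lt_pi (by linarith) (by linarith))
  rw [bisectorRatioBA, bisectorRatioBA, mul_div_mul_comm, mul_div_mul_comm]
  gcongr

lemma bisectorRatioCB_strictMono_left {a a' b : ℝ} (hb : 0 < b) (ha : b < a) (haa : a < a')
    (h : 2 * a' + b < π / 2) : bisectorRatioCB a b < bisectorRatioCB a' b := by
  have h1 := sin_div_sin_add_lt (x := 2 * a + b) (y := 2 * a' + b) (s := b)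
    (by linarith) (by linarith) (by linarith) (by linarith)
  have h2 : cos (a' - b) < cos (a - b) :=
    cos_lt_cos_of_nonneg_of_le_pi_div_two (by linarith) (by linarith) (by linarith)
  have p1 : 0 < sin (2 * b) := sin_pos_of_pos_of_lt_pi (by linarith) (by linarith)
  have p2 : 0 < cos (a' - b) := cos_pos_of_mem_Ioo ⟨by linarith, by linarith⟩
  have p7 := p2.trans h2
  have p3 : 0 < sin (2 * a + b + b) := sin_pos_of_pos_of_lt_pi (by linarith) (by linarith)
  have p4 : 0 < sin (2 * a + b) := sin_pos_of_pos_of_lt_pi (by linarith) (by linarith)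
  have p5 : 0 < sin (2 * a' + b + b) := sin_pos_of_pos_of_lt_pi (by linarith) (by linarith)
  have p6 : 0 < sin (2 * a' + b) := sin_pos_of_pos_of_lt_pi (by linarith) (by linarith)
  have e (x : ℝ) : 2 * x + 2 * b = 2 * x + b + b := by ring
  rw [bisectorRatioCB, bisectorRatioCB, mul_div_mul_comm, mul_div_mul_comm, e, e]
  gcongr

/-- A decomposition of `t_C / t_B` into a sum of products of functions increasing in `b`. -/
lemma bisectorRatioCB_eq {a b : ℝ} (hb : 0 < b) (ha : b < a) (h : 2 * a + b < π / 2) :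
    bisectorRatioCB a b = sin b / sin (b + (π / 2 - a)) +
      sin (2 * a) * (sin b / sin (b + a)) / (cos (2 * a) + cos (2 * b)) := by
  have p1 : 0 < cos (a - b) := cos_pos_of_mem_Ioo ⟨by linarith, by linarith⟩
  have p2 : 0 < cos (a + b) := cos_pos_of_mem_Ioo ⟨by linarith, by linarith⟩
  have p3 : 0 < sin (b + a) := sin_pos_of_pos_of_lt_pi (by linarith) (by linarith)
  have e1 : sin (b + (π / 2 - a)) = cos (a - b) := by
    rw [← cos_pi_div_two_sub]; ring_nf
  have e2 : cos (2 * a) + cos (2 * b) = 2 * cos (a + b) * cos (a - b) := by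
    have h2 : 2 * a = (a + b) + (a - b) := by ring
    have h3 : 2 * b = (a + b) - (a - b) := by ring
    rw [h2, h3, cos_add (a + b), cos_sub (a + b)]; ring
  have e3 : sin (2 * a + 2 * b) = 2 * sin (b + a) * cos (a + b) := by
    rw [add_comm b a, ← sin_two_mul]; ring_nf
  have e4 : sin (2 * a + b) * cos b * 2 = sin (2 * a + 2 * b) + sin (2 * a) := by
    have h2 : 2 * a + 2 * b = (2 * a + b) + b := by ring
    have h3 : sin (2 * a) = sin ((2 * a + b) - b) := by ring_nf
    rw [h2, h3, sin_add (2 * a + b), sin_sub (2 * a + b)]; ring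
  rw [e3] at e4
  rw [bisectorRatioCB, e1, e2, e3, sin_two_mul b]
  field_simp
  linear_combination sin b * e4

lemma bisectorRatioCB_strictMono_right {a b b' : ℝ} (hb : 0 < b) (hbb : b < b') (ha : b' < a)
    (h : 2 * a + b' < π / 2) : bisectorRatioCB a b < bisectorRatioCB a b' := by
  rw [bisectorRatioCB_eq hb (by linarith) (by linarith), bisectorRatioCB_eq (by linarith) ha h]
  have h1 := sin_div_sin_add_lt (x := b) (y := b') (s := π / 2 - a)
    (by linarith) (by linarith) (by linarith) (by linarith)
  have h2 := sin_div_sin_add_lt (x := b) (y := b') (s := a)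
    (by linarith) (by linarith) (by linarith) (by linarith)
  have h3 : cos (2 * b') < cos (2 * b) :=
    cos_lt_cos_of_nonneg_of_le_pi_div_two (by linarith) (by linarith) (by linarith)
  have p1 : 0 < sin (2 * a) := sin_pos_of_pos_of_lt_pi (by linarith) (by linarith)
  have p2 : 0 < cos (2 * a) := cos_pos_of_mem_Ioo ⟨by linarith, by linarith⟩
  have p3 : 0 < cos (2 * b') := cos_pos_of_mem_Ioo ⟨by linarith, by linarith⟩
  have p4 : 0 < sin b / sin (b + a) :=
    div_pos (sin_pos_of_pos_of_lt_pi (by linarith) (by linarith))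
      (sin_pos_of_pos_of_lt_pi (by linarith) (by linarith))
  have p5 := p4.trans h2
  gcongr

lemma bisectorLength_eq_ratios {A B C : EuclideanSpace ℝ (Fin 2)} {a b : ℝ}
    (h : ¬ Collinear ℝ ({A, B, C} : Set (EuclideanSpace ℝ (Fin 2))))
    (ha : ∠ B A C = 2 * a) (hb : ∠ A B C = 2 * b)
    (hBA : ∠ A B C < ∠ B A C) (hAC : ∠ B A C < ∠ B C A) :
    ∠ B C A = π - 2 * a - 2 * b ∧ 0 < b ∧ b < a ∧ 2 * a + b < π / 2 ∧
    bisectorLength B C A = bisectorLength A B C * bisectorRatioBA a b ∧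
    bisectorLength C A B = bisectorLength B C A * bisectorRatioCB a b := by
  obtain ⟨hC, ha0, hb0, hab, h1, h2⟩ := bisectorLength_half_angle_relations h ha hb
  have hlt : b < a := by linarith
  have hsum : 2 * a + b < π / 2 := by linarith
  have p1 : 0 < sin (2 * b) := sin_pos_of_pos_of_lt_pi (by linarith) (by linarith)
  have p2 : 0 < sin (2 * a + b) := sin_pos_of_pos_of_lt_pi (by linarith) (by linarith)
  have p3 : 0 < sin (2 * a + 2 * b) := sin_pos_of_pos_of_lt_pi (by linarith) (by linarith)
  have p4 : 0 < cos (a - b) := cos_pos_of_mem_Ioo ⟨by linarith, by linarith⟩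
  refine ⟨hC, hb0, hlt, hsum, ?_, ?_⟩
  · rw [bisectorRatioBA, ← mul_div_assoc, eq_div_iff (by positivity), h1]
  · rw [bisectorRatioCB, ← mul_div_assoc, eq_div_iff (by positivity), h2]

theorem monotonicity_in_angleB (l₁ l₂ : ℝ) (h₂ : 0 < l₂) (h₂₁ : l₂ < l₁)
    (A B C A' B' C' : EuclideanSpace ℝ (Fin 2))
    (h : ¬ Collinear ℝ ({A, B, C} : Set (EuclideanSpace ℝ (Fin 2))))
    (h' : ¬ Collinear ℝ ({A', B', C'} : Set (EuclideanSpace ℝ (Fin 2))))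
    (hBA : ∠ A B C < ∠ B A C) (hAC : ∠ B A C < ∠ B C A)
    (hBA' : ∠ A' B' C' < ∠ B' A' C') (hAC' : ∠ B' A' C' < ∠ B' C' A')
    (htA : bisectorLength A B C = l₂) (htA' : bisectorLength A' B' C' = l₂)
    (htB : bisectorLength B C A = l₁) (htB' : bisectorLength B' C' A' = l₁)
    (hang : ∠ A B C < ∠ A' B' C') :
    bisectorLength C A B < bisectorLength C' A' B' ∧
      ∠ B A C < ∠ B' A' C' ∧ ∠ B C A > ∠ B' C' A' := by
  obtain ⟨hC, hb0, hba, hsum, hr, hs⟩ := bisectorLength_eq_ratios (a := ∠ B A C / 2)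
    (b := ∠ A B C / 2) h (by ring) (by ring) hBA hAC
  obtain ⟨hC', hb0', hba', hsum', hr', hs'⟩ := bisectorLength_eq_ratios (a := ∠ B' A' C' / 2)
    (b := ∠ A' B' C' / 2) h' (by ring) (by ring) hBA' hAC'
  set a := ∠ B A C / 2
  set b := ∠ A B C / 2
  set a' := ∠ B' A' C' / 2
  set b' := ∠ A' B' C' / 2
  have hbb : b < b' := div_lt_div_of_pos_right hang two_pos
  rw [htA, htB] at hr
  rw [htA', htB'] at hr'
  have hratio : bisectorRatioBA a b = bisectorRatioBA a' b' :=
    mul_left_cancel₀ h₂.ne' (hr.symm.trans hr')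
  have haa : a < a' := by
    by_contra! hle
    have h1 := bisectorRatioBA_strictAnti_right hb0 hbb hba' hsum'
    rcases hle.eq_or_lt with heq | hlt
    · rw [← heq] at hratio
      linarith
    · have h2 := bisectorRatioBA_strictMono_left hb0 (hbb.trans hba') hlt hsum
      linarith
  refine ⟨?_, (div_lt_div_iff_of_pos_right two_pos).1 haa, by linarith⟩
  rw [hs, hs', htB, htB']
  exact mul_lt_mul_of_pos_left
    ((bisectorRatioCB_strictMono_left hb0 hba haa (by linarith)).trans
      (bisectorRatioCB_strictMono_right hb0 hbb hba' hsum')) (h₂.trans h₂₁)
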